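/- Let 0<p<∞. There is a positive real number C_p^1 depending only on p such that for all integers n ≥ 2 and 1 ≤ m ≤ n, σ_{m−1}^{p,∞}(θ_{p,p/n−1}) ≥ C_p^1 · (Γ(n+1)/Γ(n−m+1)) · (Γ(n/p+n−m+1)/Γ(n/p+n+1)). -/

import Mathlib

open MeasureTheory Real Set
open scoped ENNReal

noncomputable section

/-- The `m`-th largest value among `|x_1|, …, |x_n|` (for `1 ≤ m ≤ n`). -/
def kthMax {ι : Type*} [Fintype ι] (x : ι → ℝ) (m : ℕ) : ℝ :=
  sSup {t : ℝ | ∃ S : Finset ι, m ≤ S.card ∧ ∀ j ∈ S, t ≤ |x j|}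

/-- The positive part `Δ_p^n` of the unit sphere of `ℓ_p^n`:
`Δ_p^n = {t ∈ [0,∞)^n : ∑_j t_j^p = 1}`. -/
def Delta (p : ℝ) (n : ℕ) : Set (Fin n → ℝ) :=
  {t | (∀ i, 0 ≤ t i) ∧ ∑ i, t i ^ p = 1}

/-- The cone `[0,1] · A = {t • a : t ∈ [0,1], a ∈ A}`. -/
def cone {n : ℕ} (A : Set (Fin n → ℝ)) : Set (Fin n → ℝ) :=
  {x | ∃ t ∈ Icc (0 : ℝ) 1, ∃ a ∈ A, x = t • a}

/-- `μ` is the normalized cone measure on `Δ_p^n`: it is a Borel probability measure with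
`μ(A) = λ([0,1]·A) / λ([0,1]·Δ_p^n)` for every Borel `A ⊆ Δ_p^n`. -/
def IsConeMeasure (p : ℝ) (n : ℕ) (μ : Measure (Fin n → ℝ)) : Prop :=
  IsProbabilityMeasure μ ∧
    ∀ A : Set (Fin n → ℝ), MeasurableSet A → A ⊆ Delta p n →
      μ A = volume (cone A) / volume (cone (Delta p n))

/-- The distribution on `[0,∞)` with density `c_p e^{-t^p}`, `c_p = p / Γ(1/p)`. -/
def expMeasure (p : ℝ) : Measure ℝ :=
  (volume.restrict (Ioi (0 : ℝ))).withDensity fun t =>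
    ENNReal.ofReal ((p / Real.Gamma (1 / p)) * Real.exp (-(t ^ p)))

/-- Joint distribution of `n` i.i.d. random variables with density `c_p e^{-t^p}` on `[0,∞)`. -/
def iidExp (p : ℝ) (n : ℕ) : Measure (Fin n → ℝ) := Measure.pi fun _ => expMeasure p


/-- The distribution on `(0,∞)` with density proportional to `t^β e^{-t^p}`. -/
def gmeasure (p β : ℝ) : Measure ℝ :=
  (volume.restrict (Ioi (0 : ℝ))).withDensity fun t =>
    ENNReal.ofReal ((∫ s in Ioi (0 : ℝ), s ^ β * Real.exp (-(s ^ p)))⁻¹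
      * (t ^ β * Real.exp (-(t ^ p))))

/-- The measure `θ_{p,β}` on `Δ_p^n`: the distribution of `ω'/‖ω'‖_p`, where `ω'_1, …, ω'_n`
are i.i.d. with density proportional to `t^β e^{-t^p}` on `(0,∞)`. -/
def thetaMeasure (p β : ℝ) (n : ℕ) : Measure (Fin n → ℝ) :=
  Measure.map (fun ω i => ω i / (∑ j, |ω j| ^ p) ^ (1 / p))
    (Measure.pi fun _ : Fin n => gmeasure p β)


lemma kth_bdd {n : ℕ} (x : Fin n → ℝ) (m : ℕ) (hm : 1 ≤ m) :
    BddAbove {t : ℝ | ∃ S : Finset (Fin n), m ≤ S.card ∧ ∀ j ∈ S, t ≤ |x j|} := by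
  refine ⟨∑ j, |x j|, ?_⟩
  rintro t ⟨S, hS, h⟩
  obtain ⟨j, hj⟩ : S.Nonempty := Finset.card_pos.mp (by omega)
  exact (h j hj).trans (Finset.single_le_sum (f := fun j => |x j|) (fun i _ => abs_nonneg _)
    (Finset.mem_univ j))

lemma kth_zero_mem {n : ℕ} (x : Fin n → ℝ) (m : ℕ) (hm : m ≤ n) :
    (0:ℝ) ∈ {t : ℝ | ∃ S : Finset (Fin n), m ≤ S.card ∧ ∀ j ∈ S, t ≤ |x j|} :=
  ⟨Finset.univ, by simpa using hm, fun j _ => abs_nonneg _⟩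

lemma kth_nonneg {n : ℕ} (x : Fin n → ℝ) (m : ℕ) (h1 : 1 ≤ m) (hm : m ≤ n) :
    0 ≤ kthMax x m := le_csSup (kth_bdd x m h1) (kth_zero_mem x m hm)

lemma kth_mono {n : ℕ} (x y : Fin n → ℝ) (m : ℕ) (h1 : 1 ≤ m) (hm : m ≤ n)
    (h : ∀ j, |x j| ≤ |y j|) : kthMax x m ≤ kthMax y m := by
  apply csSup_le_csSup (kth_bdd y m h1) ⟨0, kth_zero_mem x m hm⟩
  rintro t ⟨S, hS, hh⟩
  exact ⟨S, hS, fun j hj => (hh j hj).trans (h j)⟩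

lemma kth_le {n : ℕ} (x : Fin n → ℝ) (m : ℕ) (h1 : 1 ≤ m) (hm : m ≤ n) (c : ℝ)
    (h : ∀ j, |x j| ≤ c) : kthMax x m ≤ c := by
  apply csSup_le ⟨0, kth_zero_mem x m hm⟩
  rintro t ⟨S, hS, hh⟩
  obtain ⟨j, hj⟩ : S.Nonempty := Finset.card_pos.mp (by omega)
  exact (hh j hj).trans (h j)

lemma kth_smul {n : ℕ} (x : Fin n → ℝ) (m : ℕ) (r : ℝ) (hr : 0 < r) :
    kthMax (r • x) m = r * kthMax x m := by
  unfold kthMax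
  rw [← smul_eq_mul, ← Real.sSup_smul_of_nonneg hr.le]
  congr 1
  ext t
  rw [Set.mem_smul_set_iff_inv_smul_mem₀ hr.ne']
  simp only [mem_ofPred_eq, Pi.smul_apply, smul_eq_mul, abs_mul, abs_of_pos hr, inv_mul_le_iff₀ hr]

lemma lt_kth_iff {n : ℕ} (x : Fin n → ℝ) (m : ℕ) (h1 : 1 ≤ m) (hm : m ≤ n) (t : ℝ) :
    t < kthMax x m ↔ ∃ S : Finset (Fin n), m ≤ S.card ∧ ∀ j ∈ S, t < |x j| := by
  unfold kthMax
  rw [lt_csSup_iff (kth_bdd x m h1) ⟨0, kth_zero_mem x m hm⟩]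
  constructor
  · rintro ⟨b, ⟨S, hS, h⟩, hb⟩
    exact ⟨S, hS, fun j hj => hb.trans_le (h j hj)⟩
  · rintro ⟨S, hS, h⟩
    have hne : S.Nonempty := Finset.card_pos.mp (by omega)
    refine ⟨S.inf' hne (fun j => |x j|), ⟨S, hS, fun j hj => Finset.inf'_le _ hj⟩, ?_⟩
    rwa [Finset.lt_inf'_iff]

lemma kth_meas (n m : ℕ) (h1 : 1 ≤ m) (hm : m ≤ n) :
    Measurable (fun x : Fin n → ℝ => kthMax x m) := by
  apply measurable_of_Ioi
  intro t
  have : (fun x : Fin n → ℝ => kthMax x m) ⁻¹' Ioi t =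
      ⋃ S : Finset (Fin n), ⋃ _ : m ≤ S.card, ⋂ j ∈ S, {x | t < |x j|} := by
    ext x
    simp only [mem_preimage, mem_Ioi, lt_kth_iff x m h1 hm, mem_iUnion, mem_iInter, mem_ofPred_eq,
      exists_prop]
  rw [this]
  refine MeasurableSet.iUnion fun S => MeasurableSet.iUnion fun _ =>
    S.measurableSet_biInter fun j _ => measurableSet_lt measurable_const ?_
  fun_prop

lemma gamma_lower (x : ℝ) (hx : 0 < x) : Real.pi ^ (-x) ≤ Real.Gamma (1 + x) := by
  have h := Real.convexOn_log_Gamma.slope_mono_adjacent (x := 1/2) (y := 1) (z := 1 + x)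
    (by norm_num [Set.mem_Ioi]) (by simp only [Set.mem_Ioi]; linarith) (by norm_num) (by linarith)
  simp only [Function.comp, Real.Gamma_one_half_eq, Real.Gamma_one, Real.log_one] at h
  rw [Real.log_sqrt Real.pi_pos.le, add_sub_cancel_left, le_div_iff₀ hx] at h
  rw [Real.rpow_def_of_pos Real.pi_pos, ← Real.le_log_iff_exp_le (Real.Gamma_pos_of_pos (by linarith))]
  have h2 : (0 - Real.log Real.pi / 2) / (1 - 1 / 2) * x = Real.log Real.pi * -x := by ring
  linarith

lemma lint_prod {n : ℕ} (μ : Fin n → Measure ℝ) [∀ i, SigmaFinite (μ i)] (f : Fin n → ℝ → ℝ≥0∞)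
    (hf : ∀ i, Measurable (f i)) :
    ∫⁻ x, ∏ i, f i (x i) ∂(Measure.pi μ) = ∏ i, ∫⁻ t, f i t ∂(μ i) := by
  induction n with
  | zero => simp
  | succ k ih =>
    have mp := measurePreserving_piFinSuccAbove μ 0
    rw [(mp.symm _).lintegral_map_equiv, lintegral_prod]
    · simp only [MeasurableEquiv.piFinSuccAbove_symm_apply, Fin.prod_univ_succ,
        Fin.insertNthEquiv_apply, Fin.insertNth_zero, Fin.cons_zero, Fin.cons_succ]
      have : ∀ t : ℝ, ∫⁻ y, f 0 t * ∏ i : Fin k, f i.succ (y i)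
          ∂(Measure.pi fun j : Fin k => μ (Fin.succAbove 0 j))
          = f 0 t * ∏ i : Fin k, ∫⁻ t, f i.succ t ∂(μ i.succ) := by
        intro t
        rw [lintegral_const_mul]
        · congr 1
          exact ih (fun j => μ (Fin.succAbove 0 j)) (fun j => f j.succ) (fun j => hf _)
        · exact Finset.measurable_prod _ fun i _ => (hf _).comp (measurable_pi_apply i)
      refine (lintegral_congr fun t => this t).trans ?_
      rw [lintegral_mul_const _ (hf 0)]
    · apply Measurable.aemeasurable
      refine Measurable.comp (g := fun x : Fin (k+1) → ℝ => ∏ i, f i (x i)) ?_ (MeasurableEquiv.measurable _)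
      exact Finset.measurable_prod _ fun i _ => (hf _).comp (measurable_pi_apply i)

lemma pi_withDens {n : ℕ} (μ : Measure ℝ) [SigmaFinite μ] (f : ℝ → ℝ≥0∞) (hf : Measurable f)
    [SigmaFinite (μ.withDensity f)] :
    Measure.pi (fun _ : Fin n => μ.withDensity f) =
      (Measure.pi (fun _ : Fin n => μ)).withDensity (fun x => ∏ i, f (x i)) := by
  apply Measure.pi_eq
  intro s hs
  rw [withDensity_apply _ (MeasurableSet.univ_pi hs), ← lintegral_indicator (MeasurableSet.univ_pi hs)]
  have : ∀ x : Fin n → ℝ, (Set.univ.pi s).indicator (fun x => ∏ i, f (x i)) x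
      = ∏ i, (s i).indicator f (x i) := by
    intro x
    by_cases hx : x ∈ Set.univ.pi s
    · rw [indicator_of_mem hx]
      exact Finset.prod_congr rfl fun i _ => (indicator_of_mem (hx i (mem_univ i)) _).symm
    · rw [indicator_of_notMem hx]
      simp only [Set.mem_univ_pi, not_forall] at hx
      obtain ⟨i, hi⟩ := hx
      exact (Finset.prod_eq_zero (Finset.mem_univ i) (indicator_of_notMem hi _)).symm
  simp_rw [this]
  rw [lint_prod _ _ (fun i => hf.indicator (hs i))]
  refine Finset.prod_congr rfl fun i _ => ?_
  rw [lintegral_indicator (hs i), withDensity_apply _ (hs i)]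

structure GoodG (g : ℝ → ℝ) : Prop where
  meas : Measurable g
  cont : ContinuousOn g (Ioi 0)
  pos : ∀ t, 0 < t → 0 < g t
  int : IntegrableOn g (Ioi 0)

def gam (g : ℝ → ℝ) : Measure ℝ :=
  (volume.restrict (Ioi (0 : ℝ))).withDensity fun t => ENNReal.ofReal (g t)

def FF (g : ℝ → ℝ) (M : ℝ) : ℝ := ∫ t in (0:ℝ)..M, g t

lemma GoodG.fin {g : ℝ → ℝ} (hg : GoodG g) : IsFiniteMeasure (gam g) := by
  unfold gam
  exact isFiniteMeasure_withDensity_ofReal hg.int.2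

lemma GoodG.ii {g : ℝ → ℝ} (hg : GoodG g) {a b : ℝ} (ha : 0 ≤ a) (hb : 0 ≤ b) :
    IntervalIntegrable g volume a b := by
  rw [intervalIntegrable_iff]
  apply hg.int.mono_set
  intro x hx
  exact lt_of_le_of_lt (le_min ha hb) hx.1

lemma GoodG.Fpos {g : ℝ → ℝ} (hg : GoodG g) {M : ℝ} (hM : 0 < M) : 0 < FF g M := by
  apply intervalIntegral.intervalIntegral_pos_of_pos_on (hg.ii le_rfl hM.le) _ hM
  intro x hx
  exact hg.pos x hx.1

lemma GoodG.Fderiv {g : ℝ → ℝ} (hg : GoodG g) {M : ℝ} (hM : 0 < M) :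
    HasDerivAt (FF g) (g M) M := by
  apply intervalIntegral.integral_hasDerivAt_right (hg.ii le_rfl hM.le)
  · exact hg.meas.stronglyMeasurable.stronglyMeasurableAtFilter
  · exact hg.cont.continuousAt (Ioi_mem_nhds hM)

lemma GoodG.Fcont {g : ℝ → ℝ} (hg : GoodG g) {M : ℝ} (hM : 0 < M) :
    ContinuousOn (FF g) (Icc 0 M) := by
  have := intervalIntegral.continuousOn_primitive_interval (μ := volume) (f := g) (a := 0) (b := M)
    (by
      rw [uIcc_of_le hM.le, integrableOn_Icc_iff_integrableOn_Ioc]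
      exact hg.int.mono_set Ioc_subset_Ioi_self)
  rwa [uIcc_of_le hM.le] at this

lemma gam_restrict (g : ℝ → ℝ) (hg : Measurable g) (M : ℝ) (f : ℝ → ℝ≥0∞) (hf : Measurable f) :
    ∫⁻ r in Ioo 0 M, f r ∂(gam g) = ∫⁻ r in Ioo 0 M, ENNReal.ofReal (g r) * f r := by
  unfold gam
  rw [restrict_withDensity measurableSet_Ioo, Measure.restrict_restrict measurableSet_Ioo,
    inter_eq_left.mpr (Ioo_subset_Ioi_self), lintegral_withDensity_eq_lintegral_mul _ (by fun_prop) hf]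
  rfl

lemma GoodG.Fint {g : ℝ → ℝ} (hg : GoodG g) {M a : ℝ} (hM : 0 < M) (ha : 0 ≤ a) :
    ∫⁻ r in Ioo 0 M, ENNReal.ofReal (FF g r ^ a) ∂(gam g)
      = ENNReal.ofReal (FF g M ^ (a+1) / (a+1)) := by
  have hF0 : FF g 0 = 0 := by simp [FF]
  have hco : ContinuousOn (fun r => FF g r ^ (a+1) / (a+1)) (Icc 0 M) :=
    ((hg.Fcont hM).rpow_const (fun x _ => Or.inr (by linarith))).div_const _
  have hder : ∀ x ∈ Ioo 0 M, HasDerivAt (fun r => FF g r ^ (a+1) / (a+1)) (g x * FF g x ^ a) x := by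
    intro x hx
    have := ((hg.Fderiv hx.1).rpow_const (p := a + 1) (Or.inr (by linarith))).div_const (a+1)
    have e : g x * (a + 1) * FF g x ^ (a + 1 - 1) / (a + 1) = g x * FF g x ^ a := by
      rw [add_sub_cancel_right]
      field_simp
    rwa [e] at this
  have hnn : ∀ x ∈ Ioo 0 M, 0 ≤ g x * FF g x ^ a := fun x hx =>
    mul_nonneg (hg.pos x hx.1).le (Real.rpow_nonneg (hg.Fpos hx.1).le _)
  have hint := intervalIntegral.integrableOn_deriv_of_nonneg hco hder hnn
  have hftc := intervalIntegral.integral_eq_sub_of_hasDerivAt_of_le hM.le hco hder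
    ((intervalIntegrable_iff_integrableOn_Ioc_of_le hM.le).mpr hint)
  rw [hF0, Real.zero_rpow (by linarith), zero_div, sub_zero, intervalIntegral.integral_of_le hM.le,
    integral_Ioc_eq_integral_Ioo] at hftc
  have hFm : Measurable ((Ioo 0 M).indicator (FF g)) := by
    rw [← Set.piecewise_eq_indicator]
    exact ((hg.Fcont hM).mono Ioo_subset_Icc_self).measurable_piecewise (continuousOn_const (c := (0:ℝ))) measurableSet_Ioo
  have e1 : ∫⁻ r in Ioo 0 M, ENNReal.ofReal (FF g r ^ a) ∂(gam g)
      = ∫⁻ r in Ioo 0 M, ENNReal.ofReal ((Ioo 0 M).indicator (FF g) r ^ a) ∂(gam g) := by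
    refine setLIntegral_congr_fun measurableSet_Ioo fun r hr => ?_
    simp only [indicator_of_mem hr]
  rw [e1, gam_restrict g hg.meas M _ (by fun_prop), ← hftc,
    ofReal_integral_eq_lintegral_ofReal (hint.mono_set Ioo_subset_Ioc_self)]
  · refine setLIntegral_congr_fun measurableSet_Ioo fun r hr => ?_
    simp only [indicator_of_mem hr]
    rw [ENNReal.ofReal_mul (hg.pos r hr.1).le]
  · exact (ae_restrict_iff' measurableSet_Ioo).mpr (Filter.Eventually.of_forall hnn)

lemma GoodG.Fmeasure {g : ℝ → ℝ} (hg : GoodG g) {M : ℝ} (hM : 0 < M) :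
    gam g (Ioo 0 M) = ENNReal.ofReal (FF g M) := by
  have := hg.Fint hM (a := 0) le_rfl
  simpa using this

def Kc {k : ℕ} (x : Fin k → ℝ) (m : ℕ) (M : ℝ) : ℝ := if m = 0 then M else kthMax x m

lemma Kc_step {k : ℕ} (x : Fin (k+1) → ℝ) (m : ℕ) (hm : m ≤ k) (i : Fin (k+1))
    (hx : ∀ j, 0 < x j) (hi : ∀ j, x (i.succAbove j) < x i) :
    Kc (fun j => x (i.succAbove j)) m (x i) ≤ kthMax x (m+1) := by
  unfold Kc
  split_ifs with h0
  · subst h0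
    refine le_csSup (kth_bdd x _ (by omega)) ⟨{i}, by simp, ?_⟩
    intro j hj
    rw [Finset.mem_singleton.mp hj]
    exact le_abs_self _
  · refine csSup_le_csSup (kth_bdd x _ (by omega)) ⟨0, kth_zero_mem _ m hm⟩ ?_
    rintro t ⟨S, hS, h⟩
    have hni : i ∉ S.map i.succAboveEmb := by
      simp [Fin.succAbove_ne]
    refine ⟨insert i (S.map i.succAboveEmb), ?_, ?_⟩
    · rw [Finset.card_insert_of_notMem hni, Finset.card_map]
      omega
    · intro j hj
      rcases Finset.mem_insert.mp hj with rfl | hj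
      · obtain ⟨l, hl⟩ : S.Nonempty := Finset.card_pos.mp (by omega)
        have h1 := h l hl
        rw [abs_of_pos (hx _)] at h1 ⊢
        exact h1.trans (hi l).le
      · obtain ⟨l, hl, rfl⟩ := Finset.mem_map.mp hj
        exact h l hl

lemma Kc_meas (k m : ℕ) (hm : m ≤ k) :
    Measurable (fun z : ℝ × (Fin k → ℝ) => Kc z.2 m z.1) := by
  unfold Kc
  split_ifs with h
  · exact measurable_fst
  · exact (kth_meas k m (by omega) hm).comp measurable_snd

def cube (k : ℕ) (M : ℝ) : Set (Fin k → ℝ) := Set.univ.pi fun _ => Ioo 0 M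

def bb (s : ℝ) (k m : ℕ) : ℝ :=
  (Real.Gamma ((k : ℝ) + 1) / Real.Gamma ((k : ℝ) - m + 1))
          * (Real.Gamma (s + k - m + 1) / Real.Gamma (s + k + 1))

lemma bb_zero (s : ℝ) (hs : 0 < s) (k : ℕ) : bb s k 0 = 1 := by
  unfold bb
  have h1 : 0 < Real.Gamma ((k : ℝ) + 1) := Real.Gamma_pos_of_pos (by positivity)
  have h2 : 0 < Real.Gamma (s + k + 1) := Real.Gamma_pos_of_pos (by positivity)
  simp [h1.ne', h2.ne']

lemma bb_nonneg (s : ℝ) (hs : 0 < s) (k m : ℕ) (hm : m ≤ k) : 0 ≤ bb s k m := by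
  unfold bb
  have : (m:ℝ) ≤ k := by exact_mod_cast hm
  have h1 : 0 < Real.Gamma ((k : ℝ) + 1) := Real.Gamma_pos_of_pos (by positivity)
  have h2 : 0 < Real.Gamma (s + k + 1) := Real.Gamma_pos_of_pos (by positivity)
  have h3 : 0 < Real.Gamma ((k : ℝ) - m + 1) := Real.Gamma_pos_of_pos (by linarith)
  have h4 : 0 < Real.Gamma (s + k - m + 1) := Real.Gamma_pos_of_pos (by linarith)
  positivity

lemma bb_succ (s : ℝ) (hs : 0 < s) (k m : ℕ) :
    bb s (k+1) (m+1) = (k+1) / (k+s+1) * bb s k m := by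
  unfold bb
  push_cast
  have e1 : (k:ℝ) + 1 - (m+1) + 1 = k - m + 1 := by ring
  have e2 : s + (k + 1) - (m+1) + 1 = s + k - m + 1 := by ring
  have e3 : s + ((k:ℝ) + 1) + 1 = (s + k + 1) + 1 := by ring
  rw [e1, e2, e3, Real.Gamma_add_one (s := (k:ℝ)+1) (by positivity),
    Real.Gamma_add_one (s := s + k + 1) (by positivity)]
  have : (k:ℝ) + s + 1 = s + k + 1 := by ring
  rw [this, mul_div_assoc, mul_comm (s + k + 1), ← div_div, div_div, mul_comm (Real.Gamma _) (s + k + 1)]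
  field_simp

lemma GoodG.main {g : ℝ → ℝ} (hg : GoodG g) (s c : ℝ) (hs : 0 < s) (hc : 0 ≤ c)
    (hF : ∀ M, 0 < M → c * FF g M ^ s ≤ M) (m : ℕ) :
    ∀ k, m ≤ k → ∀ M, 0 < M →
      ENNReal.ofReal (c * bb s k m * FF g M ^ ((k:ℝ) + s)) ≤
        ∫⁻ x in cube k M, ENNReal.ofReal (Kc x m M) ∂(Measure.pi fun _ => gam g) := by
  have := hg.fin
  induction m with
  | zero =>
    intro k _ M hM
    have hp := hg.Fpos hM
    simp only [Kc, if_true, lintegral_const, cube]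
    rw [Measure.restrict_apply_univ, Measure.pi_pi, Finset.prod_const, hg.Fmeasure hM,
      Finset.card_univ, Fintype.card_fin, ← ENNReal.ofReal_pow hp.le, ← ENNReal.ofReal_mul hM.le,
      bb_zero s hs, Real.rpow_add hp, Real.rpow_natCast]
    apply ENNReal.ofReal_le_ofReal
    calc c * 1 * (FF g M ^ k * FF g M ^ s) = (c * FF g M ^ s) * FF g M ^ k := by ring
      _ ≤ _ := by gcongr; exact hF M hM
  | succ m ih =>
    intro k hk M hM
    obtain ⟨k, rfl⟩ : ∃ l, k = l + 1 := ⟨k - 1, by omega⟩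
    have hmk : m ≤ k := by omega
    set μ : Measure (Fin (k+1) → ℝ) := Measure.pi fun _ => gam g with hμ
    set E : Fin (k+1) → Set (Fin (k+1) → ℝ) := fun i =>
      {x | x i ∈ Ioo 0 M ∧ ∀ j, x (i.succAbove j) ∈ Ioo 0 (x i)} with hE
    have hEm : ∀ i, MeasurableSet (E i) := by
      intro i
      have : E i = (fun x => x i) ⁻¹' Ioo 0 M ∩ ⋂ j, ({x | 0 < x (i.succAbove j)} ∩
          {x | x (i.succAbove j) < x i}) := by
        ext x
        simp [hE]
      rw [this]
      refine (measurable_pi_apply i measurableSet_Ioo).inter (MeasurableSet.iInter fun j => ?_)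
      exact (measurableSet_lt measurable_const (measurable_pi_apply _)).inter
        (measurableSet_lt (measurable_pi_apply _) (measurable_pi_apply _))
    have hEs : ∀ i, ∀ x ∈ E i, (∀ j, 0 < x j) ∧ ∀ j, x j < M := by
      intro i x hx
      rw [← forall_and]
      intro j
      rcases Fin.eq_self_or_eq_succAbove i j with rfl | ⟨l, rfl⟩
      · exact ⟨hx.1.1, hx.1.2⟩
      · exact ⟨(hx.2 l).1, (hx.2 l).2.trans hx.1.2⟩
    have hEsub : (⋃ i, E i) ⊆ cube (k+1) M := by
      intro x hx
      obtain ⟨i, hi⟩ := mem_iUnion.mp hx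
      exact fun j _ => ⟨(hEs i x hi).1 j, (hEs i x hi).2 j⟩
    have hdisj : Pairwise (Function.onFun Disjoint E) := by
      intro i j hij
      refine Set.disjoint_left.mpr fun x hi hj => ?_
      obtain ⟨l, hl⟩ := Fin.exists_succAbove_eq hij.symm
      obtain ⟨l', hl'⟩ := Fin.exists_succAbove_eq hij
      have h1 := (hi.2 l).2
      have h2 := (hj.2 l').2
      rw [hl] at h1
      rw [hl'] at h2
      exact lt_asymm h1 h2
    have hb := bb_nonneg s hs k m hmk
    have hpiece : ∀ i, ENNReal.ofReal (c * bb s k m * (FF g M ^ ((k:ℝ) + s + 1) / ((k:ℝ) + s + 1)))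
        ≤ ∫⁻ x in E i, ENNReal.ofReal (kthMax x (m+1)) ∂μ := by
      intro i
      have mp := measurePreserving_piFinSuccAbove (fun _ : Fin (k+1) => gam g) i
      set H : ℝ × (Fin k → ℝ) → ℝ≥0∞ := fun z =>
        (Ioo 0 M).indicator (fun r => (cube k r).indicator (fun y => ENNReal.ofReal (Kc y m r)) z.2) z.1
        with hH
      have hHm : Measurable H := by
        have : H = ({z : ℝ × (Fin k → ℝ) | z.1 ∈ Ioo 0 M} ∩ ⋂ j, {z | 0 < z.2 j} ∩ {z | z.2 j < z.1}).indicator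
            (fun z => ENNReal.ofReal (Kc z.2 m z.1)) := by
          ext z
          simp only [hH, indicator, cube, Set.mem_univ_pi, mem_inter_iff, mem_iInter, mem_ofPred_eq]
          by_cases h1 : z.1 ∈ Ioo 0 M <;> simp [h1]
        rw [this]
        refine (Kc_meas k m hmk).ennreal_ofReal.indicator ?_
        refine (measurable_fst measurableSet_Ioo).inter (MeasurableSet.iInter fun j => ?_)
        exact (measurableSet_lt measurable_const (by fun_prop)).inter
          (measurableSet_lt (by fun_prop) (by fun_prop))
      have step1 : ∫⁻ z, H z ∂((gam g).prod (Measure.pi fun _ : Fin k => gam g))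
          ≤ ∫⁻ x in E i, ENNReal.ofReal (kthMax x (m+1)) ∂μ := by
        rw [← lintegral_indicator (hEm i), mp.lintegral_map_equiv]
        refine lintegral_mono fun x => ?_
        simp only [hH, MeasurableEquiv.piFinSuccAbove_apply, Fin.insertNthEquiv_symm_apply]
        by_cases hx : x ∈ E i
        · rw [indicator_of_mem hx]
          refine (indicator_le_self' (fun _ _ => zero_le) _).trans ?_
          refine (indicator_le_self' (fun _ _ => zero_le) _).trans ?_
          exact ENNReal.ofReal_le_ofReal (Kc_step x m hmk i (hEs i x hx).1 fun j => (hx.2 j).2)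
        · rw [indicator_of_notMem hx, nonpos_iff_eq_zero]
          by_cases h1 : x i ∈ Ioo 0 M
          · rw [indicator_of_mem h1, indicator_of_notMem]
            intro h2
            exact hx ⟨h1, fun j => h2 j (mem_univ j)⟩
          · rw [indicator_of_notMem h1]
      refine le_trans ?_ step1
      rw [lintegral_prod _ hHm.aemeasurable]
      have step2 : ∀ r, ∫⁻ y, H (r, y) ∂(Measure.pi fun _ : Fin k => gam g) =
          (Ioo 0 M).indicator (fun r => ∫⁻ y in cube k r, ENNReal.ofReal (Kc y m r)
            ∂(Measure.pi fun _ : Fin k => gam g)) r := by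
        intro r
        by_cases hr : r ∈ Ioo 0 M
        · simp only [hH, indicator_of_mem hr]
          rw [lintegral_indicator]
          exact MeasurableSet.univ_pi fun _ => measurableSet_Ioo
        · simp [hH, indicator_of_notMem hr]
      simp_rw [step2]
      rw [lintegral_indicator measurableSet_Ioo, ENNReal.ofReal_mul (by positivity),
        ← hg.Fint hM (a := (k:ℝ) + s) (by positivity), ← lintegral_const_mul' _ _ ENNReal.ofReal_ne_top]
      refine setLIntegral_mono' measurableSet_Ioo fun r hr => ?_
      rw [← ENNReal.ofReal_mul (by positivity)]
      exact ih k hmk r hr.1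
    have hpF := hg.Fpos hM
    calc ENNReal.ofReal (c * bb s (k+1) (m+1) * FF g M ^ (((k+1 : ℕ):ℝ) + s))
        = ∑ i : Fin (k+1), ENNReal.ofReal (c * bb s k m * (FF g M ^ ((k:ℝ) + s + 1) / ((k:ℝ) + s + 1))) := by
          rw [Finset.sum_const, Finset.card_univ, Fintype.card_fin, nsmul_eq_mul,
            ← ENNReal.ofReal_natCast, ← ENNReal.ofReal_mul (by positivity), bb_succ s hs]
          congr 1
          push_cast
          have : (k:ℝ) + 1 + s = k + s + 1 := by ring
          rw [this]
          ring
      _ ≤ ∑ i, ∫⁻ x in E i, ENNReal.ofReal (kthMax x (m+1)) ∂μ := Finset.sum_le_sum fun i _ => hpiece i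
      _ = ∫⁻ x in ⋃ i, E i, ENNReal.ofReal (kthMax x (m+1)) ∂μ := by
          rw [lintegral_iUnion hEm hdisj, tsum_fintype]
      _ ≤ ∫⁻ x in cube (k+1) M, ENNReal.ofReal (kthMax x (m+1)) ∂μ := lintegral_mono_set hEsub
      _ = _ := by simp [Kc]

lemma lint_gamma (a : ℝ) (ha : 0 ≤ a) :
    ∫⁻ t in Ioi (0:ℝ), ENNReal.ofReal (Real.exp (-t)) * ENNReal.ofReal (t ^ a)
      = ENNReal.ofReal (Real.Gamma (a + 1)) := by
  have hi := Real.GammaIntegral_convergent (s := a + 1) (by linarith)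
  rw [add_sub_cancel_right] at hi
  rw [Real.Gamma_eq_integral (by linarith), add_sub_cancel_right,
    ofReal_integral_eq_lintegral_ofReal hi]
  · refine lintegral_congr fun t => ?_
    rw [ENNReal.ofReal_mul (Real.exp_pos _).le]
  · refine (ae_restrict_iff' measurableSet_Ioi).mpr (Filter.Eventually.of_forall fun t ht => ?_)
    exact mul_nonneg (Real.exp_pos _).le (Real.rpow_nonneg (le_of_lt ht) _)

lemma lint_exp (c : ℝ) :
    ∫⁻ t in Ioi c, ENNReal.ofReal (Real.exp (-t)) = ENNReal.ofReal (Real.exp (-c)) := by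
  rw [← integral_exp_neg_Ioi c, ofReal_integral_eq_lintegral_ofReal (integrableOn_exp_neg_Ioi c)]
  exact Filter.Eventually.of_forall fun t => (Real.exp_pos _).le

lemma J_scale {n : ℕ} (p q : ℝ) (hp : 0 < p) (h : (Fin n → ℝ) → ℝ≥0∞) (hh : Measurable h)
    (S : (Fin n → ℝ) → ℝ) (hS : Measurable S)
    (hhs : ∀ r : ℝ, 0 < r → ∀ x, h (r • x) = ENNReal.ofReal (r ^ q) * h x)
    (hSs : ∀ r : ℝ, 0 < r → ∀ x, S (r • x) = r ^ p * S x) (t : ℝ) (ht : 0 < t) :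
    ∫⁻ x, {x | S x < t}.indicator h x =
      ENNReal.ofReal (t ^ ((q + n) / p)) * ∫⁻ x, {x | S x < 1}.indicator h x := by
  set r := t ^ (1 / p) with hr
  have hr0 : 0 < r := Real.rpow_pos_of_pos ht _
  have hrp : r ^ p = t := by
    rw [hr, ← Real.rpow_mul ht.le, one_div_mul_cancel hp.ne', Real.rpow_one]
  have hm : ∀ t, Measurable ({x | S x < t}.indicator h) := fun t =>
    hh.indicator (measurableSet_lt hS measurable_const)
  have key : ∫⁻ x, {x | S x < t}.indicator h (r • x)
      = ENNReal.ofReal (r ^ q) * ∫⁻ x, {x | S x < 1}.indicator h x := by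
    rw [← lintegral_const_mul _ (hm 1)]
    refine lintegral_congr fun x => ?_
    have : S (r • x) < t ↔ S x < 1 := by
      rw [hSs r hr0, hrp]
      exact mul_lt_iff_lt_one_right ht
    by_cases hx : S x < 1
    · rw [indicator_of_mem (show r • x ∈ {x | S x < t} from this.mpr hx),
        indicator_of_mem (show x ∈ {x | S x < 1} from hx), hhs r hr0]
    · rw [indicator_of_notMem (show r • x ∉ {x | S x < t} from fun h => hx (this.mp h)),
        indicator_of_notMem (show x ∉ {x | S x < 1} from hx), mul_zero]
  have key2 : ∫⁻ x, {x | S x < t}.indicator h (r • x)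
      = ENNReal.ofReal ((r ^ n)⁻¹) * ∫⁻ x, {x | S x < t}.indicator h x := by
    rw [← lintegral_map (f := {x | S x < t}.indicator h) (g := fun x : Fin n → ℝ => r • x) (hm t)
      (measurable_const_smul r), Measure.map_addHaar_smul volume hr0.ne', lintegral_smul_measure]
    simp only [Module.finrank_fintype_fun_eq_card, Fintype.card_fin, smul_eq_mul]
    rw [abs_of_pos (by positivity)]
  rw [key] at key2
  have e : t ^ ((q + n) / p) = r ^ n * r ^ q := by
    rw [← Real.rpow_natCast, ← Real.rpow_add hr0, hr, ← Real.rpow_mul ht.le]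
    congr 1
    ring
  rw [e, ENNReal.ofReal_mul (by positivity), mul_assoc, key2, ← mul_assoc,
    ← ENNReal.ofReal_mul (by positivity), mul_inv_cancel₀ (by positivity), ENNReal.ofReal_one, one_mul]

lemma lapl {n : ℕ} (p q : ℝ) (hp : 0 < p) (hq : 0 ≤ q + n) (h : (Fin n → ℝ) → ℝ≥0∞) (hh : Measurable h)
    (S : (Fin n → ℝ) → ℝ) (hS : Measurable S) (hS0 : ∀ x, 0 ≤ S x)
    (hhs : ∀ r : ℝ, 0 < r → ∀ x, h (r • x) = ENNReal.ofReal (r ^ q) * h x)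
    (hSs : ∀ r : ℝ, 0 < r → ∀ x, S (r • x) = r ^ p * S x) :
    ∫⁻ x, h x * ENNReal.ofReal (Real.exp (- S x)) =
      ENNReal.ofReal (Real.Gamma ((q + n) / p + 1)) * ∫⁻ x, {x | S x < 1}.indicator h x := by
  have e1 : ∀ x, h x * ENNReal.ofReal (Real.exp (- S x)) =
      ∫⁻ t in Ioi (0:ℝ), ENNReal.ofReal (Real.exp (-t)) * {x | S x < t}.indicator h x := by
    intro x
    rw [← lint_exp, ← lintegral_const_mul _ (by fun_prop), ← lintegral_indicator measurableSet_Ioi,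
      ← lintegral_indicator measurableSet_Ioi]
    refine lintegral_congr fun t => ?_
    by_cases ht : S x < t
    · rw [indicator_of_mem (show t ∈ Ioi (S x) from ht),
        indicator_of_mem (show t ∈ Ioi (0:ℝ) from (hS0 x).trans_lt ht),
        indicator_of_mem (show x ∈ {x | S x < t} from ht), mul_comm]
    · rw [indicator_of_notMem (show t ∉ Ioi (S x) from ht)]
      refine (indicator_apply_eq_zero.mpr fun _ => ?_).symm
      rw [indicator_of_notMem (show x ∉ {x | S x < t} from ht), mul_zero]
  simp_rw [e1]
  rw [lintegral_lintegral_swap]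
  · rw [← lint_gamma _ (div_nonneg hq hp.le), ← lintegral_mul_const _ (by fun_prop)]
    refine setLIntegral_congr_fun measurableSet_Ioi fun t ht => ?_
    rw [lintegral_const_mul _ (hh.indicator (measurableSet_lt hS measurable_const)),
      J_scale p q hp h hh S hS hhs hSs t ht, mul_assoc]
  · apply Measurable.aemeasurable
    have : (Function.uncurry fun x t => ENNReal.ofReal (Real.exp (-t)) * {x | S x < t}.indicator h x)
        = fun z : (Fin n → ℝ) × ℝ => ENNReal.ofReal (Real.exp (-z.2)) *
          {z : (Fin n → ℝ) × ℝ | S z.1 < z.2}.indicator (fun z => h z.1) z := by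
      ext ⟨x, t⟩
      simp [Function.uncurry, indicator]
    rw [this]
    refine Measurable.mul (by fun_prop) ((hh.comp measurable_fst).indicator ?_)
    exact measurableSet_lt (hS.comp measurable_fst) measurable_snd

def gfun (p β : ℝ) (t : ℝ) : ℝ :=
  (∫ s in Ioi (0 : ℝ), s ^ β * Real.exp (-(s ^ p)))⁻¹ * (t ^ β * Real.exp (-(t ^ p)))

lemma gfun_Z (p : ℝ) (hp : 0 < p) (n : ℕ) (hn : 1 ≤ n) :
    ∫ s in Ioi (0 : ℝ), s ^ (p / n - 1) * Real.exp (-(s ^ p)) = n / p * Real.Gamma (1 + 1 / n) := by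
  have hn' : (0:ℝ) < n := by exact_mod_cast hn
  have : 0 < p / n := by positivity
  rw [integral_rpow_mul_exp_neg_rpow hp (by linarith), add_comm 1 (1 / (n:ℝ)),
    Real.Gamma_add_one (by positivity)]
  have e : (p / n - 1 + 1) / p = 1 / (n:ℝ) := by
    field_simp
    ring
  rw [e]
  field_simp

lemma gfun_good (p : ℝ) (hp : 0 < p) (n : ℕ) (hn : 1 ≤ n) : GoodG (gfun p (p / n - 1)) := by
  have hn' : (0:ℝ) < n := by exact_mod_cast hn
  have h0 : 0 < p / n := by positivity
  have hG : 0 < Real.Gamma (1 + 1 / n) := Real.Gamma_pos_of_pos (by positivity)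
  refine ⟨?_, ?_, ?_, ?_⟩
  · unfold gfun
    fun_prop
  · unfold gfun
    intro x hx
    have hx' : x ≠ 0 := ne_of_gt hx
    refine ContinuousAt.continuousWithinAt ?_
    refine continuousAt_const.mul ((Real.continuousAt_rpow_const _ _ (Or.inl hx')).mul ?_)
    exact (Real.continuousAt_rpow_const _ _ (Or.inl hx')).neg.rexp
  · intro t ht
    unfold gfun
    rw [gfun_Z p hp n hn]
    positivity
  · exact (integrableOn_rpow_mul_exp_neg_rpow (by linarith) hp).const_mul _

lemma gfun_F (p : ℝ) (hp : 0 < p) (n : ℕ) (hn : 1 ≤ n) (M : ℝ) (hM : 0 < M) :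
    Real.pi ^ (-(1/p)) * FF (gfun p (p / n - 1)) M ^ ((n:ℝ) / p) ≤ M := by
  have hn' : (0:ℝ) < n := by exact_mod_cast hn
  have h0 : 0 < p / n := by positivity
  have hG : 0 < Real.Gamma (1 + 1 / n) := Real.Gamma_pos_of_pos (by positivity)
  have hgood := gfun_good p hp n hn
  have h1 : FF (gfun p (p / n - 1)) M ≤ Real.pi ^ (1 / (n:ℝ)) * M ^ (p / n) := by
    have : FF (gfun p (p / n - 1)) M ≤
        ∫ t in (0:ℝ)..M, (n / p * Real.Gamma (1 + 1 / n))⁻¹ * t ^ (p / n - 1) := by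
      unfold FF
      apply intervalIntegral.integral_mono_on_of_le_Ioo hM.le (hgood.ii le_rfl hM.le)
      · exact (intervalIntegral.intervalIntegrable_rpow' (by linarith)).const_mul _
      · intro t ht
        unfold gfun
        rw [gfun_Z p hp n hn]
        have h2 : Real.exp (-(t ^ p)) ≤ 1 := by
          rw [Real.exp_le_one_iff, neg_nonpos]
          exact Real.rpow_nonneg ht.1.le _
        have h3 : 0 ≤ t ^ (p / n - 1) := Real.rpow_nonneg ht.1.le _
        gcongr
        exact mul_le_of_le_one_right h3 h2
    refine this.trans ?_
    rw [intervalIntegral.integral_const_mul, integral_rpow (Or.inl (by linarith)), sub_add_cancel,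
      Real.zero_rpow h0.ne', sub_zero]
    have h2 := gamma_lower (1 / n) (by positivity)
    rw [Real.rpow_neg Real.pi_pos.le] at h2
    have h3 := inv_anti₀ (by positivity) h2
    rw [inv_inv] at h3
    calc (n / p * Real.Gamma (1 + 1 / n))⁻¹ * (M ^ (p / n) / (p / n))
        = (Real.Gamma (1 + 1 / n))⁻¹ * M ^ (p / n) := by field_simp
      _ ≤ _ := by gcongr
  have h2 := Real.rpow_le_rpow (hgood.Fpos hM).le h1 (show 0 ≤ (n:ℝ) / p by positivity)
  rw [Real.mul_rpow (by positivity) (by positivity), ← Real.rpow_mul Real.pi_pos.le,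
    ← Real.rpow_mul hM.le] at h2
  have e1 : 1 / (n:ℝ) * (n / p) = 1 / p := by field_simp
  have e2 : p / (n:ℝ) * (n / p) = 1 := by field_simp
  rw [e1, e2, Real.rpow_one] at h2
  rw [Real.rpow_neg Real.pi_pos.le]
  exact (inv_mul_le_iff₀ (by positivity)).mpr h2

lemma kth_gam_lower (p : ℝ) (hp : 0 < p) (n m : ℕ) (h1 : 1 ≤ m) (hm : m ≤ n) :
    ENNReal.ofReal (Real.pi ^ (-(1/p)) * bb (n / p) n m) ≤
      ∫⁻ x, ENNReal.ofReal (kthMax x m) ∂(Measure.pi fun _ : Fin n => gmeasure p (p / n - 1)) := by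
  have hn : 1 ≤ n := by omega
  have hn' : (0:ℝ) < n := by exact_mod_cast hn
  have hgood := gfun_good p hp n hn
  have hG : 0 < Real.Gamma (1 + 1 / n) := Real.Gamma_pos_of_pos (by positivity)
  have hF1 : Filter.Tendsto (FF (gfun p (p / n - 1))) Filter.atTop (nhds 1) := by
    have := intervalIntegral_tendsto_integral_Ioi 0 hgood.int Filter.tendsto_id
    have e : ∫ x in Ioi 0, gfun p (p / n - 1) x = 1 := by
      unfold gfun
      rw [integral_const_mul, gfun_Z p hp n hn, inv_mul_cancel₀ (by positivity)]
    rw [e] at this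
    exact this
  have hlim : Filter.Tendsto (fun M => ENNReal.ofReal (Real.pi ^ (-(1/p)) * bb (n / p) n m *
      FF (gfun p (p / n - 1)) M ^ ((n:ℝ) + n / p))) Filter.atTop
      (nhds (ENNReal.ofReal (Real.pi ^ (-(1/p)) * bb (n / p) n m))) := by
    apply ENNReal.tendsto_ofReal
    have := (hF1.rpow_const (p := (n:ℝ) + n / p) (Or.inl one_ne_zero)).const_mul
      (Real.pi ^ (-(1/p)) * bb (n / p) n m)
    rwa [Real.one_rpow, mul_one] at this
  refine le_of_tendsto hlim ?_
  filter_upwards [Filter.eventually_gt_atTop 0] with M hM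
  refine (hgood.main (n / p) _ (by positivity) (by positivity) (gfun_F p hp n hn) m n hm M hM).trans ?_
  refine (setLIntegral_le_lintegral _ _).trans ?_
  refine le_of_eq ?_
  have : m ≠ 0 := by omega
  simp only [Kc, this, if_false]
  rfl

def uu (c β : ℝ) (t : ℝ) : ℝ≥0∞ := (Ioi (0:ℝ)).indicator (fun t => ENNReal.ofReal (c * t ^ β)) t

lemma uu_meas (c β : ℝ) : Measurable (uu c β) :=
  Measurable.indicator (by fun_prop) measurableSet_Ioi

lemma uu_scale (c β r t : ℝ) (hr : 0 < r) :
    uu c β (r * t) = ENNReal.ofReal (r ^ β) * uu c β t := by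
  unfold uu
  by_cases ht : 0 < t
  · rw [indicator_of_mem (show r * t ∈ Ioi (0:ℝ) from mul_pos hr ht),
      indicator_of_mem (show t ∈ Ioi (0:ℝ) from ht), ← ENNReal.ofReal_mul (by positivity),
      Real.mul_rpow hr.le ht.le]
    congr 1
    ring
  · have h2 : ¬ 0 < r * t := fun h => ht (pos_of_mul_pos_right h hr.le)
    rw [indicator_of_notMem (show r * t ∉ Ioi (0:ℝ) from h2),
      indicator_of_notMem (show t ∉ Ioi (0:ℝ) from ht), mul_zero]

lemma gmeasure_eq (p β : ℝ) (c : ℝ)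
    (hc : c = (∫ s in Ioi (0 : ℝ), s ^ β * Real.exp (-(s ^ p)))⁻¹) (hc0 : 0 ≤ c) :
    gmeasure p β = volume.withDensity
      (fun t => uu c β t * ENNReal.ofReal (Real.exp (-(|t| ^ p)))) := by
  unfold gmeasure
  rw [← withDensity_indicator measurableSet_Ioi, ← hc]
  congr 1
  ext t
  unfold uu
  by_cases ht : t ∈ Ioi (0:ℝ)
  · have ht' : 0 < t := ht
    rw [indicator_of_mem ht, indicator_of_mem ht, ← ENNReal.ofReal_mul (by positivity),
      abs_of_pos ht']
    congr 1
    ring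
  · rw [indicator_of_notMem ht, indicator_of_notMem ht, zero_mul]

lemma compare (p : ℝ) (hp : 0 < p) (n m : ℕ) (h1 : 1 ≤ m) (hm : m ≤ n) :
    ∫⁻ x, ENNReal.ofReal (kthMax x m) ∂(Measure.pi fun _ : Fin n => gmeasure p (p / n - 1)) ≤
    ENNReal.ofReal (Real.Gamma (2 + 1 / p) * Real.exp 1) *
      ∫⁻ x, ENNReal.ofReal (kthMax (fun i => x i / (∑ j, |x j| ^ p) ^ (1 / p)) m)
        ∂(Measure.pi fun _ : Fin n => gmeasure p (p / n - 1)) := by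
  have hn : 1 ≤ n := by omega
  have hn' : (0:ℝ) < n := by exact_mod_cast hn
  have hG : 0 < Real.Gamma (1 + 1 / n) := Real.Gamma_pos_of_pos (by positivity)
  have hG2 : 0 < Real.Gamma (2 + 1 / p) := Real.Gamma_pos_of_pos (by positivity)
  set β := p / n - 1 with hβ
  obtain ⟨c, hc⟩ : ∃ c, c = (∫ s in Ioi (0 : ℝ), s ^ β * Real.exp (-(s ^ p)))⁻¹ := ⟨_, rfl⟩
  have hc0 : 0 ≤ c := by
    rw [hc, hβ, gfun_Z p hp n hn]
    positivity
  have hfin : IsFiniteMeasure (gmeasure p β) := (gfun_good p hp n hn).fin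
  set S : (Fin n → ℝ) → ℝ := fun x => ∑ j, |x j| ^ p with hS
  set W : (Fin n → ℝ) → ℝ≥0∞ := fun x => ∏ i, uu c β (x i) with hW
  have hSm : Measurable S := by fun_prop
  have hS0 : ∀ x, 0 ≤ S x := fun x => Finset.sum_nonneg fun i _ => Real.rpow_nonneg (abs_nonneg _) _
  have hWm : Measurable W :=
    Finset.measurable_prod _ fun i _ => (uu_meas c β).comp (measurable_pi_apply i)
  have hpi : Measure.pi (fun _ : Fin n => gmeasure p β) =
      volume.withDensity (fun x => W x * ENNReal.ofReal (Real.exp (-S x))) := by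
    have hfin2 := hfin
    rw [gmeasure_eq p β c hc hc0] at hfin2 ⊢
    have hdd : Measurable (fun t => uu c β t * ENNReal.ofReal (Real.exp (-(|t| ^ p)))) :=
      (uu_meas c β).mul (by fun_prop)
    rw [pi_withDens volume _ hdd, volume_pi]
    congr 1
    ext x
    rw [Finset.prod_mul_distrib, ← ENNReal.ofReal_prod_of_nonneg (fun i _ => (Real.exp_pos _).le),
      ← Real.exp_sum, Finset.sum_neg_distrib]
  have hkm := kth_meas n m h1 hm
  have hNm : Measurable (fun (x : Fin n → ℝ) i => x i / S x ^ (1 / p)) :=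
    measurable_pi_lambda _ fun i => (measurable_pi_apply i).div (hSm.pow_const _)
  have hNk : Measurable (fun x : Fin n → ℝ => ENNReal.ofReal
      (kthMax (fun i => x i / (∑ j, |x j| ^ p) ^ (1 / p)) m)) := (hkm.comp hNm).ennreal_ofReal
  have hdm : Measurable (fun x => W x * ENNReal.ofReal (Real.exp (-S x))) :=
    hWm.mul (by fun_prop)
  rw [hpi, lintegral_withDensity_eq_lintegral_mul _ hdm hkm.ennreal_ofReal,
    lintegral_withDensity_eq_lintegral_mul _ hdm hNk]
  set h : (Fin n → ℝ) → ℝ≥0∞ := fun x => ENNReal.ofReal (kthMax x m) * W x with hh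
  have hhm : Measurable h := hkm.ennreal_ofReal.mul hWm
  have hL := lapl p (n * β + 1) hp (by
      have : (n:ℝ) * β + 1 + n = p + 1 := by
        rw [hβ]
        field_simp
        ring
      rw [this]
      positivity) h hhm S hSm hS0 (by
      intro r hr x
      simp only [hh, hW, kth_smul x m r hr, Pi.smul_apply, smul_eq_mul, uu_scale c β r _ hr]
      rw [Finset.prod_mul_distrib, Finset.prod_const, Finset.card_univ, Fintype.card_fin,
        ENNReal.ofReal_mul hr.le, ← ENNReal.ofReal_pow (by positivity), Real.rpow_add hr,
        Real.rpow_one, mul_comm (n:ℝ) β, Real.rpow_mul hr.le, Real.rpow_natCast,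
        ENNReal.ofReal_mul (by positivity)]
      ring) (by
      intro r hr x
      simp only [hS, Pi.smul_apply, smul_eq_mul, abs_mul, abs_of_pos hr]
      rw [Finset.mul_sum]
      exact Finset.sum_congr rfl fun i _ => Real.mul_rpow hr.le (abs_nonneg _))
  have e : ((n:ℝ) * β + 1 + n) / p + 1 = 2 + 1 / p := by
    rw [hβ]
    field_simp
    ring
  rw [e] at hL
  calc _
      = ∫⁻ x, h x * ENNReal.ofReal (Real.exp (-S x)) := by
        refine lintegral_congr fun x => ?_
        simp only [hh, Pi.mul_apply]
        ring
    _ = _ := hL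
    _ ≤ _ := ?_
  rw [ENNReal.ofReal_mul hG2.le, mul_assoc]
  gcongr
  rw [← lintegral_const_mul' _ _ ENNReal.ofReal_ne_top]
  refine lintegral_mono fun x => ?_
  by_cases hx : S x < 1
  · rw [indicator_of_mem (show x ∈ {x | S x < 1} from hx)]
    simp only [hh, Pi.mul_apply]
    have a1 : ENNReal.ofReal (kthMax x m) ≤ ENNReal.ofReal (kthMax (fun i => x i / S x ^ (1 / p)) m) := by
      apply ENNReal.ofReal_le_ofReal
      apply kth_mono _ _ _ h1 hm
      intro j
      have hj : |x j| ^ p ≤ S x :=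
        Finset.single_le_sum (f := fun j => |x j| ^ p)
          (fun i _ => Real.rpow_nonneg (abs_nonneg _) _) (Finset.mem_univ j)
      rcases (hS0 x).eq_or_lt with h0 | h0
      · rw [← h0] at hj
        have : |x j| = 0 := by
          by_contra hne
          have := Real.rpow_pos_of_pos (lt_of_le_of_ne (abs_nonneg (x j)) (Ne.symm hne)) p
          linarith
        rw [this]
        exact abs_nonneg _
      · have hp1 : 0 < S x ^ (1 / p) := Real.rpow_pos_of_pos h0 _
        rw [abs_div, abs_of_pos hp1]
        exact le_div_self (abs_nonneg _) hp1 (Real.rpow_le_one h0.le hx.le (by positivity))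
    have a2 : 1 ≤ ENNReal.ofReal (Real.exp 1) * ENNReal.ofReal (Real.exp (-S x)) := by
      rw [← ENNReal.ofReal_mul (Real.exp_pos _).le, ← Real.exp_add, ENNReal.one_le_ofReal,
        Real.one_le_exp_iff]
      linarith
    calc ENNReal.ofReal (kthMax x m) * W x = 1 * (W x * ENNReal.ofReal (kthMax x m)) := by ring
      _ ≤ (ENNReal.ofReal (Real.exp 1) * ENNReal.ofReal (Real.exp (-S x))) *
          (W x * ENNReal.ofReal (kthMax (fun i => x i / S x ^ (1 / p)) m)) := by gcongr
      _ = _ := by ring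
  · rw [indicator_of_notMem (show x ∉ {x | S x < 1} from hx)]
    exact zero_le

/-- For `0 < p < ∞` there is `C_p^1 > 0` depending only on `p` such that for all `n ≥ 2` and
`1 ≤ m ≤ n`,
`σ_{m-1}^{p,∞}(θ_{p,p/n-1}) ≥ C_p^1 (Γ(n+1)/Γ(n-m+1)) (Γ(n/p+n-m+1)/Γ(n/p+n+1))`. -/
theorem theta_width_lower (p : ℝ) (hp : 0 < p) :
    ∃ C : ℝ, 0 < C ∧ ∀ n m : ℕ, 2 ≤ n → 1 ≤ m → m ≤ n →
      C * (Real.Gamma ((n : ℝ) + 1) / Real.Gamma ((n : ℝ) - m + 1))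
          * (Real.Gamma ((n : ℝ) / p + n - m + 1) / Real.Gamma ((n : ℝ) / p + n + 1))
        ≤ ∫ x, kthMax x m ∂(thetaMeasure p (p / n - 1) n) := by
  have hG2 : 0 < Real.Gamma (2 + 1 / p) := Real.Gamma_pos_of_pos (by positivity)
  have hpi := Real.pi_pos
  set K := Real.Gamma (2 + 1 / p) * Real.exp 1 with hK
  have hK0 : 0 < K := by positivity
  refine ⟨K⁻¹ * Real.pi ^ (-(1/p)), by positivity, ?_⟩
  intro n m hn2 h1 hm
  have hn : 1 ≤ n := by omega
  have hkm := kth_meas n m h1 hm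
  have hfin : IsFiniteMeasure (gmeasure p (p / n - 1)) := (gfun_good p hp n hn).fin
  have hSm : Measurable (fun x : Fin n → ℝ => ∑ j, |x j| ^ p) := by fun_prop
  have hNm : Measurable (fun (x : Fin n → ℝ) i => x i / (∑ j, |x j| ^ p) ^ (1 / p)) :=
    measurable_pi_lambda _ fun i => (measurable_pi_apply i).div (hSm.pow_const _)
  rw [integral_eq_lintegral_of_nonneg_ae
    (Filter.Eventually.of_forall fun x => kth_nonneg x m h1 hm) hkm.aestronglyMeasurable]
  unfold thetaMeasure
  rw [lintegral_map hkm.ennreal_ofReal hNm]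
  set I := ∫⁻ x, ENNReal.ofReal (kthMax (fun i => x i / (∑ j, |x j| ^ p) ^ (1 / p)) m)
        ∂(Measure.pi fun _ : Fin n => gmeasure p (p / n - 1)) with hI
  have hIfin : I ≠ ⊤ := by
    have : I ≤ ∫⁻ _x, 1 ∂(Measure.pi fun _ : Fin n => gmeasure p (p / n - 1)) := by
      refine lintegral_mono fun x => ?_
      rw [ENNReal.ofReal_le_one]
      apply kth_le _ _ h1 hm
      intro j
      have h0 : 0 ≤ ∑ j, |x j| ^ p := Finset.sum_nonneg fun i _ => Real.rpow_nonneg (abs_nonneg _) _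
      have hj : |x j| ^ p ≤ ∑ j, |x j| ^ p :=
        Finset.single_le_sum (f := fun j => |x j| ^ p)
          (fun i _ => Real.rpow_nonneg (abs_nonneg _) _) (Finset.mem_univ j)
      have h2 := Real.rpow_le_rpow (Real.rpow_nonneg (abs_nonneg _) _) hj
        (show 0 ≤ 1 / p by positivity)
      rw [← Real.rpow_mul (abs_nonneg _), mul_one_div_cancel hp.ne', Real.rpow_one] at h2
      rw [abs_div, abs_of_nonneg (Real.rpow_nonneg h0 _)]
      exact div_le_one_of_le₀ h2 (Real.rpow_nonneg h0 _)
    refine ne_top_of_le_ne_top ?_ this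
    rw [lintegral_one]
    exact measure_ne_top _ _
  have key := (kth_gam_lower p hp n m h1 hm).trans (compare p hp n m h1 hm)
  rw [← hK, ← hI, ← ENNReal.ofReal_toReal hIfin, ← ENNReal.ofReal_mul hK0.le,
    ENNReal.ofReal_le_ofReal_iff (by positivity)] at key
  have : K⁻¹ * (Real.pi ^ (-(1/p)) * bb (n / p) n m) ≤ I.toReal := by
    rwa [inv_mul_le_iff₀ hK0]
  unfold bb at this
  simpa only [mul_assoc] using this

end
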